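/- Let G be a nonempty position with c(G) < 2 and no 3-chains. If G contains a 4-loop, then opening a 4-loop is optimal. Regardless of whether G contains a 4-loop: if c(G) + 4·f(G) ≥ 2, then v(G) = 0, 1, 2, 3, 4 according to whether c(G) ≡ 0, ±1, ±2, ±3, 4 (mod 8); while if c(G) + 4·f(G) < 2, then v(G) = 2 if c(G) ≡ 2 (mod 4), and otherwise v(G) is whichever of 0 and 1 is congruent to c(G) mod 2 if f(G) is odd, and whichever of 3 and 4 is congruent to c(G) mod 2 if f(G) is even. -/

import Mathlib

namespace DotsAndBoxes

/-- A component of a Dots & Boxes endgame position: an `n`-chain or an `n`-loop. -/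
inductive Component : Type where
  | chain (n : ℕ)
  | loop (n : ℕ)
deriving DecidableEq

namespace Component

/-- The number of boxes in a component. -/
def size : Component → ℕ
  | chain n => n
  | loop n => n

def isChain : Component → Bool
  | chain _ => true
  | loop _ => false

def isLoop : Component → Bool
  | chain _ => false
  | loop _ => true

/-- A chain must have length at least 3; a loop must have even length at least 4. -/
def Valid : Component → Prop
  | chain n => 3 ≤ n
  | loop n => 4 ≤ n ∧ Even n

end Component

/-- A position is a finite multiset of components. -/
abbrev Position := Multiset Component

def Position.Valid (G : Position) : Prop := ∀ C ∈ G, C.Valid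

/-- The number of unclaimed boxes in a position. -/
def size (G : Position) : ℕ := (G.map Component.size).sum

/-- The number of chains of a position. -/
def numChains (G : Position) : ℕ := Multiset.card (G.filter fun C => C.isChain = true)

/-- The number of loops of a position. -/
def numLoops (G : Position) : ℕ := Multiset.card (G.filter fun C => C.isLoop = true)

/-- θ(G), the number of 3-chains. -/
def theta (G : Position) : ℕ := G.count (Component.chain 3)

/-- f(G), the number of 4-loops. -/
def numF (G : Position) : ℕ := G.count (Component.loop 4)

/-- s(G), the number of 6-loops. -/
def numS (G : Position) : ℕ := G.count (Component.loop 6)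

open Classical in
/-- The terminal bonus tb(G). -/
noncomputable def tb (G : Position) : ℤ :=
  if G = 0 then 0
  else if ∀ C ∈ G, C.isLoop = true then 8
  else if (∃ C ∈ G, C.isLoop = true) ∧ Component.chain 3 ∈ G ∧
      (∀ C ∈ G, C.isChain = true → C = Component.chain 3) then 6
  else 4

/-- The controlled value c(G). -/
noncomputable def cval (G : Position) : ℤ :=
  (size G : ℤ) - 4 * (numChains G : ℤ) - 8 * (numLoops G : ℤ) + tb G

/-- The score v(G;C) of opening component `C`, given that the remainder of the
position has value `w`. -/
def openVal (C : Component) (w : ℤ) : ℤ :=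
  match C with
  | Component.chain n => ((n : ℤ) - 2) + |w - 2|
  | Component.loop n => ((n : ℤ) - 4) + |w - 4|

/-- Auxiliary recursion (on the number of components) for the value `v`. -/
noncomputable def valueAux : ℕ → Position → ℤ
  | 0, _ => 0
  | n + 1, G =>
    if G = 0 then 0
    else sInf { x : ℤ | ∃ C ∈ G, x = openVal C (valueAux n (G.erase C)) }

/-- The value v(G): v(∅) = 0, and v(G) = min over components C of G of v(G;C). -/
noncomputable def value (G : Position) : ℤ := valueAux (Multiset.card G) G

/-- v(G;C), the value of G given that the opener has just opened C. -/
noncomputable def valueOpen (G : Position) (C : Component) : ℤ :=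
  openVal C (value (G.erase C))

/-- Opening a component C of G is optimal if C ∈ G and v(G;C) = v(G). -/
def Optimal (G : Position) (C : Component) : Prop :=
  C ∈ G ∧ valueOpen G C = value G


theorem value_zero : value 0 = 0 := by simp [value, valueAux]

theorem value_spec (G : Position) (hne : G ≠ 0) :
    (∃ C ∈ G, value G = valueOpen G C) ∧ ∀ C ∈ G, value G ≤ valueOpen G C := by
  obtain ⟨n, hn⟩ : ∃ n, Multiset.card G = n + 1 :=
    ⟨Multiset.card G - 1, by have := Multiset.card_pos.2 hne; omega⟩
  have hv : value G = sInf { x : ℤ | ∃ C ∈ G, x = valueOpen G C } := by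
    unfold value
    rw [hn, valueAux, if_neg hne]
    congr 1
    ext x
    constructor
    · rintro ⟨C, hC, rfl⟩
      refine ⟨C, hC, ?_⟩
      have : Multiset.card (G.erase C) = n := by
        rw [Multiset.card_erase_of_mem hC, hn]; rfl
      rw [valueOpen, value, this]
    · rintro ⟨C, hC, rfl⟩
      refine ⟨C, hC, ?_⟩
      have : Multiset.card (G.erase C) = n := by
        rw [Multiset.card_erase_of_mem hC, hn]; rfl
      rw [valueOpen, value, this]
  have hfin : ({ x : ℤ | ∃ C ∈ G, x = valueOpen G C }).Finite := by
    refine ((G.toFinset.finite_toSet).image (valueOpen G)).subset ?_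
    rintro x ⟨C, hC, rfl⟩
    exact ⟨C, by simpa using hC, rfl⟩
  have hnon : ({ x : ℤ | ∃ C ∈ G, x = valueOpen G C }).Nonempty := by
    obtain ⟨C, hC⟩ := Multiset.exists_mem_of_ne_zero hne
    exact ⟨_, C, hC, rfl⟩
  constructor
  · have := Int.csInf_mem hnon hfin.bddBelow
    rw [← hv] at this
    exact this
  · intro C hC
    rw [hv]
    exact csInf_le hfin.bddBelow ⟨C, hC, rfl⟩

/-- The controlled value without terminal bonus. -/
def base (G : Position) : ℤ :=
  (size G : ℤ) - 4 * (numChains G : ℤ) - 8 * (numLoops G : ℤ)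

theorem base_zero : base 0 = 0 := by simp [base, size, numChains, numLoops]

theorem base_chain (n : ℕ) (H : Position) :
    base (Component.chain n ::ₘ H) = base H + n - 4 := by
  unfold base size numChains numLoops
  rw [Multiset.filter_cons_of_pos _ (by simp [Component.isChain]),
    Multiset.filter_cons_of_neg _ (by simp [Component.isLoop]), Multiset.map_cons,
    Multiset.sum_cons, Multiset.card_cons]
  simp only [Component.size]
  push_cast
  ring

theorem base_loop (n : ℕ) (H : Position) :
    base (Component.loop n ::ₘ H) = base H + n - 8 := by
  unfold base size numChains numLoops
  rw [Multiset.filter_cons_of_neg _ (by simp [Component.isChain]),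
    Multiset.filter_cons_of_pos _ (by simp [Component.isLoop]), Multiset.map_cons,
    Multiset.sum_cons, Multiset.card_cons]
  simp only [Component.size]
  push_cast
  ring

theorem base_nonneg (G : Position) (hG : G.Valid) (h3 : Component.chain 3 ∉ G)
    (h4 : Component.loop 4 ∉ G) (h6 : Component.loop 6 ∉ G) : 0 ≤ base G := by
  induction G using Multiset.induction_on with
  | empty => simp [base_zero]
  | cons C H ih =>
    have hC : C.Valid := hG C (by simp)
    have := ih (fun D hD => hG D (by simp [hD])) (fun h => h3 (by simp [h]))
      (fun h => h4 (by simp [h])) (fun h => h6 (by simp [h]))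
    cases C with
    | chain n =>
      rw [base_chain]
      have : n ≠ 3 := by rintro rfl; simp at h3
      simp only [Component.Valid] at hC
      omega
    | loop n =>
      rw [base_loop]
      have : n ≠ 4 := by rintro rfl; simp at h4
      have : n ≠ 6 := by rintro rfl; simp at h6
      obtain ⟨h, k, hk⟩ := hC
      omega

theorem cval_zero : cval 0 = 0 := by simp [cval, tb, size, numChains, numLoops]

theorem cval_loops (G : Position) (hne : G ≠ 0) (h : ∀ C ∈ G, C.isLoop = true) :
    cval G = base G + 8 := by
  unfold cval tb base
  rw [if_neg hne, if_pos h]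

theorem cval_chain (G : Position) (h3 : Component.chain 3 ∉ G)
    (h : ¬ ∀ C ∈ G, C.isLoop = true) : cval G = base G + 4 := by
  have hne : G ≠ 0 := by rintro rfl; simp at h
  unfold cval tb base
  rw [if_neg hne, if_neg h, if_neg (fun h => h3 h.2.1)]

theorem step_chain (n : ℕ) (H : Position) (h3 : Component.chain 3 ∉ Component.chain n ::ₘ H)
    (hH : H ≠ 0) :
    (cval H = cval (Component.chain n ::ₘ H) - n + 4 ∨
      cval H = cval (Component.chain n ::ₘ H) - n + 8) ∧
    ((∃ C ∈ H, C.isLoop = false) →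
      cval H = cval (Component.chain n ::ₘ H) - n + 4) := by
  have h3' : Component.chain 3 ∉ H := fun h => h3 (by simp [h])
  have e := cval_chain _ h3 (by simp [Component.isLoop])
  rw [base_chain] at e
  by_cases h : ∀ C ∈ H, C.isLoop = true
  · have := cval_loops H hH h
    refine ⟨by omega, ?_⟩
    rintro ⟨C, hC, h'⟩
    simp [h C hC] at h'
  · have := cval_chain H h3' h
    omega

theorem step_loop (n : ℕ) (H : Position) (h3 : Component.chain 3 ∉ Component.loop n ::ₘ H)
    (hH : H ≠ 0) : cval H = cval (Component.loop n ::ₘ H) - n + 8 := by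
  have h3' : Component.chain 3 ∉ H := fun h => h3 (by simp [h])
  by_cases h : ∀ C ∈ H, C.isLoop = true
  · have := cval_loops H hH h
    have e := cval_loops (Component.loop n ::ₘ H) (by simp)
      (by intro C hC; rcases Multiset.mem_cons.1 hC with rfl | hC
          · rfl
          · exact h C hC)
    rw [base_loop] at e
    omega
  · have := cval_chain H h3' h
    have e := cval_chain _ h3 (fun h' => h fun C hC => h' C (by simp [hC]))
    rw [base_loop] at e
    omega

/-- The claimed closed formula for the value. -/
def formula (c f : ℤ) : ℤ :=
  if 2 ≤ c then c
  else if 2 ≤ c + 4 * f then (if c % 8 ≤ 4 then c % 8 else 8 - c % 8)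
  else if c % 4 = 2 then 2
  else if f % 2 = 1 then c % 2
  else 4 - c % 2

theorem formula_four (c f : ℤ) (hf : 1 ≤ f) :
    formula c f = |formula (c + 4) (f - 1) - 4| := by
  unfold formula
  rcases abs_cases ((formula (c + 4) (f - 1)) - 4) with h | h <;> unfold formula at h <;>
    rw [h.1] <;> have := h.2 <;> clear h <;> split_ifs at * <;> omega

theorem formula_facts (c f : ℤ) : (2 ≤ c → formula c f = c) ∧ formula c f % 2 = c % 2 ∧
    (formula c f % 4 = 2 ↔ c % 4 = 2) ∧ 0 ≤ formula c f ∧ (c < 2 → formula c f ≤ 4) := by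
  unfold formula
  split_ifs <;> omega

theorem formula_small (c f : ℤ) (hc : c < 2) :
    formula c f = 4 ∧ c % 4 = 0 ∨ formula c f = 3 ∧ c % 2 = 1 ∨ formula c f ≤ 2 := by
  unfold formula
  split_ifs <;> omega

theorem formula_chain (c f c' f' n : ℤ) (hn : 4 ≤ n) (hc : c' = c - n + 4 ∨ c' = c - n + 8) :
    formula c f ≤ n - 2 + |formula c' f' - 2| := by
  have h2 := formula_facts c' f'
  have ha := le_abs_self (formula c' f' - 2)
  have hb := neg_abs_le (formula c' f' - 2)
  by_cases h : 2 ≤ c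
  · rw [(formula_facts c f).1 h]
    by_cases h' : 2 ≤ c'
    · rw [h2.1 h'] at *
      omega
    · omega
  · obtain ⟨-, h3, h4, -, -⟩ := h2
    rcases formula_small c f (by omega) with ⟨h5, h6⟩ | ⟨h5, h6⟩ | h5
    · rw [h5]
      have : n ≠ 4 ∨ formula c' f' ≠ 2 := by omega
      omega
    · rw [h5]
      omega
    · omega

theorem formula_loop (c f c' f' n : ℤ) (hn : 6 ≤ n) (h2n : n % 2 = 0) (hc : c' = c - n + 8) :
    formula c f ≤ n - 4 + |formula c' f' - 4| := by
  have h2 := formula_facts c' f'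
  have ha := le_abs_self (formula c' f' - 4)
  have hb := neg_abs_le (formula c' f' - 4)
  by_cases h : 2 ≤ c
  · rw [(formula_facts c f).1 h]
    by_cases h' : 2 ≤ c'
    · rw [h2.1 h'] at *
      omega
    · omega
  · obtain ⟨-, h3, h4, -, -⟩ := h2
    rcases formula_small c f (by omega) with ⟨h5, h6⟩ | ⟨h5, h6⟩ | h5
    · rw [h5]
      have : n ≠ 6 ∨ formula c' f' ≠ 4 := by omega
      omega
    · rw [h5]
      omega
    · omega

theorem formula_six (c : ℤ) : formula c 0 = 2 + |formula (c + 2) 0 - 4| := by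
  rcases abs_cases ((formula (c + 2) 0) - 4) with h | h <;> rw [h.1] <;> have := h.2 <;>
    clear h <;> unfold formula at * <;> split_ifs at * <;> omega

theorem value_formula : ∀ (N : ℕ) (G : Position), Multiset.card G = N → G.Valid → G ≠ 0 →
    Component.chain 3 ∉ G →
    value G = formula (cval G) (numF G) ∧
    (Component.loop 4 ∈ G → valueOpen G (Component.loop 4) = formula (cval G) (numF G)) := by
  intro N
  induction N with
  | zero => intro G h _ hne; exact absurd (Multiset.card_eq_zero.1 h) hne
  | succ N ih =>
    intro G hcard hG hne h3
    by_cases h1 : ∃ C, G = {C}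
    · obtain ⟨C, rfl⟩ := h1
      obtain ⟨⟨D, hD, hv⟩, -⟩ := value_spec {C} hne
      obtain rfl : D = C := by simpa using hD
      have hopen : valueOpen {D} D = openVal D 0 := by simp [valueOpen, value_zero]
      have hDv : D.Valid := hG D (by simp)
      have key : openVal D 0 = formula (cval {D}) (numF {D}) := by
        cases D with
        | chain n =>
          have e := cval_chain {Component.chain n} h3 (by simp [Component.isLoop])
          have := base_chain n 0
          rw [base_zero] at this
          simp only [Multiset.cons_zero] at this
          simp only [Component.Valid] at hDv
          rw [(formula_facts _ _).1 (by omega)]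
          simp [openVal]
          omega
        | loop n =>
          have e := cval_loops {Component.loop n} hne (by simp [Component.isLoop])
          have := base_loop n 0
          rw [base_zero] at this
          simp only [Multiset.cons_zero] at this
          have := hDv.1
          rw [(formula_facts _ _).1 (by omega)]
          simp [openVal]
          omega
      refine ⟨by rw [hv, hopen, key], fun h => ?_⟩
      obtain rfl : Component.loop 4 = D := by simpa using h
      rw [hopen, key]
    have hH0 : ∀ C ∈ G, G.erase C ≠ 0 := by
      intro C hC h0
      exact h1 ⟨C, by rw [← Multiset.cons_erase hC, h0]; rfl⟩
    have hopen : ∀ C ∈ G, valueOpen G C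
        = openVal C (formula (cval (G.erase C)) (numF (G.erase C))) := by
      intro C hC
      rw [valueOpen, (ih (G.erase C) (by rw [Multiset.card_erase_of_mem hC, hcard]; rfl)
        (fun D hD => hG D (Multiset.mem_of_mem_erase hD)) (hH0 C hC)
        (fun h => h3 (Multiset.mem_of_mem_erase h))).1]
    have hchain : ∀ n, Component.chain n ∈ G →
        (cval (G.erase (Component.chain n)) = cval G - n + 4 ∨
          cval (G.erase (Component.chain n)) = cval G - n + 8) ∧
        ((∃ C ∈ G.erase (Component.chain n), C.isLoop = false) →
          cval (G.erase (Component.chain n)) = cval G - n + 4) := by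
      intro n hn
      have := step_chain n (G.erase (Component.chain n)) (by rwa [Multiset.cons_erase hn]) (hH0 _ hn)
      rwa [Multiset.cons_erase hn] at this
    have hloop : ∀ n, Component.loop n ∈ G →
        cval (G.erase (Component.loop n)) = cval G - n + 8 := by
      intro n hn
      have := step_loop n (G.erase (Component.loop n)) (by rwa [Multiset.cons_erase hn]) (hH0 _ hn)
      rwa [Multiset.cons_erase hn] at this
    -- opening a 4-loop attains the formula
    have four : Component.loop 4 ∈ G →
        valueOpen G (Component.loop 4) = formula (cval G) (numF G) := by
      intro h4
      have hf : 1 ≤ numF G := Multiset.one_le_count_iff_mem.2 h4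
      have hf' : numF (G.erase (Component.loop 4)) = numF G - 1 := by
        simp [numF]
      have e := hloop 4 h4
      have key := formula_four (cval G) (numF G) (by omega)
      rw [hopen _ h4, key, hf', e]
      simp only [openVal]
      rw [show cval G - ((4 : ℕ) : ℤ) + 8 = cval G + 4 by push_cast; ring]
      push_cast [hf]
      ring_nf
    have lower : ∀ C ∈ G, formula (cval G) (numF G) ≤ valueOpen G C := by
      intro C hC
      have hCv := hG C hC
      by_cases h4 : C = Component.loop 4
      · subst h4
        exact (four hC).ge
      rw [hopen C hC]
      cases C with
      | chain n =>
        have : n ≠ 3 := by rintro rfl; exact h3 hC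
        simp only [Component.Valid] at hCv
        exact formula_chain _ _ _ _ _ (by omega) (hchain n hC).1
      | loop n =>
        have : n ≠ 4 := by rintro rfl; exact h4 rfl
        obtain ⟨h, k, hk⟩ := hCv
        exact formula_loop _ _ _ _ _ (by omega) (by omega) (hloop n hC)
    have upper : ∃ C ∈ G, valueOpen G C = formula (cval G) (numF G) := by
      by_cases h4 : Component.loop 4 ∈ G
      · exact ⟨_, h4, four h4⟩
      have hf : numF G = 0 := Multiset.count_eq_zero.2 h4
      have hfe : ∀ C, numF (G.erase C) = 0 := fun C =>
        Multiset.count_eq_zero.2 fun h => h4 (Multiset.mem_of_mem_erase h)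
      by_cases h6 : Component.loop 6 ∈ G
      · refine ⟨_, h6, ?_⟩
        have e := hloop 6 h6
        rw [hopen _ h6, hf, hfe, e]
        simp only [openVal]
        have := formula_six (cval G)
        rw [show cval G - ((6 : ℕ) : ℤ) + 8 = cval G + 2 by push_cast; ring]
        push_cast
        omega
      have hbe : ∀ C, 4 ≤ cval (G.erase C) ∨ G.erase C = 0 := by
        intro C
        have hsub : ∀ D, D ∈ G.erase C → D ∈ G := fun D => Multiset.mem_of_mem_erase
        have hb := base_nonneg (G.erase C) (fun D hD => hG D (hsub D hD))
          (fun h => h3 (hsub _ h)) (fun h => h4 (hsub _ h)) (fun h => h6 (hsub _ h))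
        by_cases h0 : G.erase C = 0
        · exact Or.inr h0
        left
        by_cases h : ∀ D ∈ G.erase C, D.isLoop = true
        · have := cval_loops _ h0 h
          omega
        · have := cval_chain _ (fun h => h3 (hsub _ h)) h
          omega
      by_cases hl : ∃ n, Component.loop n ∈ G
      · obtain ⟨n, hn⟩ := hl
        refine ⟨_, hn, ?_⟩
        have e := hloop n hn
        have hb := (hbe (Component.loop n)).resolve_right (hH0 _ hn)
        obtain ⟨hCv, k, hk⟩ := hG _ hn
        have : n ≠ 4 := by rintro rfl; exact h4 hn
        have : n ≠ 6 := by rintro rfl; exact h6 hn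
        rw [hopen _ hn, (formula_facts _ _).1 (by omega), (formula_facts _ _).1 (by omega)]
        simp only [openVal]
        rw [abs_of_nonneg (by omega)]
        omega
      · obtain ⟨C, hC⟩ := Multiset.exists_mem_of_ne_zero hne
        cases C with
        | loop n => exact absurd ⟨n, hC⟩ hl
        | chain n =>
          refine ⟨_, hC, ?_⟩
          have e := (hchain n hC).2 (by
            obtain ⟨D, hD⟩ := Multiset.exists_mem_of_ne_zero (hH0 _ hC)
            refine ⟨D, hD, ?_⟩
            cases D with
            | loop m => exact absurd ⟨m, Multiset.mem_of_mem_erase hD⟩ hl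
            | chain m => rfl)
          have hb := (hbe (Component.chain n)).resolve_right (hH0 _ hC)
          have hCv : 3 ≤ n := hG _ hC
          have : n ≠ 3 := by rintro rfl; exact h3 hC
          rw [hopen _ hC, (formula_facts _ _).1 (by omega), (formula_facts _ _).1 (by omega)]
          simp only [openVal]
          rw [abs_of_nonneg (by omega)]
          omega
    refine ⟨le_antisymm ?_ ?_, four⟩
    · obtain ⟨C, hC, h⟩ := upper
      rw [← h]
      exact (value_spec G hne).2 C hC
    · obtain ⟨C, hC, h⟩ := (value_spec G hne).1
      rw [h]
      exact lower C hC

/-- Second example of 4-loop optimality: c(G) < 2 and G nonempty with no 3-chains.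
If G has a 4-loop then opening it is optimal, and v(G) is as described. -/
theorem four_loop_optimality_two (G : Position) (hG : G.Valid) (hne : G ≠ 0)
    (hc : cval G < 2) (hth : theta G = 0) :
    (Component.loop 4 ∈ G → Optimal G (Component.loop 4)) ∧
    (2 ≤ cval G + 4 * (numF G : ℤ) →
      (cval G % 8 = 0 → value G = 0) ∧
      (cval G % 8 = 1 ∨ cval G % 8 = 7 → value G = 1) ∧
      (cval G % 8 = 2 ∨ cval G % 8 = 6 → value G = 2) ∧
      (cval G % 8 = 3 ∨ cval G % 8 = 5 → value G = 3) ∧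
      (cval G % 8 = 4 → value G = 4)) ∧
    (cval G + 4 * (numF G : ℤ) < 2 →
      (cval G % 4 = 2 → value G = 2) ∧
      (cval G % 4 ≠ 2 →
        (Odd (numF G) → (Even (cval G) → value G = 0) ∧ (Odd (cval G) → value G = 1)) ∧
        (Even (numF G) → (Odd (cval G) → value G = 3) ∧ (Even (cval G) → value G = 4)))) := by
  obtain ⟨hv, h4⟩ := value_formula _ G rfl hG hne (Multiset.count_eq_zero.1 hth)
  refine ⟨fun h => ⟨h, (h4 h).trans hv.symm⟩, ?_, ?_⟩
  · intro h
    rw [hv, formula, if_neg (by omega), if_pos h]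
    split_ifs <;> omega
  · intro h
    rw [hv, formula, if_neg (by omega), if_neg (by omega), Nat.odd_iff, Nat.even_iff,
      Int.even_iff, Int.odd_iff]
    split_ifs <;> omega

end DotsAndBoxes
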